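/- Let G be a finite group. Then the intersection of all maximal nilpotent subgroups U of G such that U is not K-N-subnormal in G equals the intersection of all maximal nilpotent subgroups of G. (Here an intersection over the empty family is understood to be G.) -/

import Mathlib

/-- `U` is a maximal nilpotent subgroup of `G`. -/
def IsMaximalNilpotent {G : Type*} [Group G] (U : Subgroup G) : Prop :=
  Group.IsNilpotent U ∧ ∀ V : Subgroup G, U ≤ V → Group.IsNilpotent V → U = V

/-- `H` is `K`-`𝒩`-subnormal in `G` (where `𝒩` is the class of nilpotent groups):
either `H = G`, or there is a chain `H = H_0 < H_1 < ... < H_t = G` such that for each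
`i`, either `H_{i-1}` is normal in `H_i`, or the quotient of `H_i` by the normal core of
`H_{i-1}` in `H_i` is nilpotent. -/
def IsKNilpotentSubnormal {G : Type*} [Group G] (H : Subgroup G) : Prop :=
  H = ⊤ ∨ ∃ (t : ℕ) (c : ℕ → Subgroup G), c 0 = H ∧ c t = ⊤ ∧
    ∀ i < t, c i < c (i + 1) ∧
      ((∀ g ∈ c (i + 1), ∀ n ∈ c i, g * n * g⁻¹ ∈ c i) ∨
        Group.IsNilpotent (↥(c (i + 1)) ⧸ ((c i).subgroupOf (c (i + 1))).normalCore))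

open scoped Pointwise

namespace Subgroup

variable {G : Type*} [Group G]

theorem commutator_le_iff_le_comap_centralizer {H K L : Subgroup G} [L.Normal] :
    ⁅H, K⁆ ≤ L ↔
      H ≤ (centralizer (K.map (QuotientGroup.mk' L) : Set (G ⧸ L))).comap
        (QuotientGroup.mk' L) := by
  rw [← map_le_iff_le_comap, ← commutator_eq_bot_iff_le_centralizer, ← map_commutator,
    map_eq_bot_iff, QuotientGroup.ker_mk']

theorem commutator_sup_le {H M N L : Subgroup G} [L.Normal] (hM : ⁅H, M⁆ ≤ L)
    (hN : ⁅H, N⁆ ≤ L) : ⁅H, M ⊔ N⁆ ≤ L := by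
  rw [commutator_comm, commutator_le_iff_le_comap_centralizer] at *
  exact sup_le hM hN

/-- The lower central series of `S`, preceded by the whole group. -/
def extendedLowerCentralSeries (S : Subgroup G) : ℕ → Subgroup G
  | 0 => ⊤
  | n + 1 => S.lowerCentralSeries n

instance extendedLowerCentralSeries_normal (S : Subgroup G) [S.Normal] (n : ℕ) :
    (S.extendedLowerCentralSeries n).Normal := by
  cases n <;> (unfold extendedLowerCentralSeries; infer_instance)

theorem commutator_extendedLowerCentralSeries_le (S : Subgroup G) [S.Normal] (n : ℕ) :
    ⁅S.extendedLowerCentralSeries n, S⁆ ≤ S.extendedLowerCentralSeries (n + 1) := by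
  cases n with
  | zero => exact commutator_le_right _ _
  | succ n => exact le_rfl

theorem lowerCentralSeries_sup_le (M N : Subgroup G) [M.Normal] [N.Normal] (n : ℕ)
    (L : Subgroup G) [L.Normal]
    (hL : ∀ a b, a + b = n + 1 →
      M.extendedLowerCentralSeries a ⊓ N.extendedLowerCentralSeries b ≤ L) :
    (M ⊔ N).lowerCentralSeries n ≤ L := by
  induction n generalizing L with
  | zero =>
    refine sup_le ?_ ?_
    · simpa [extendedLowerCentralSeries] using hL 1 0 rfl
    · simpa [extendedLowerCentralSeries] using hL 0 1 rfl
  | succ n ih =>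
    rw [lowerCentralSeries_succ, commutator_le_iff_le_comap_centralizer]
    have : ((M ⊔ N).map (QuotientGroup.mk' L)).Normal :=
      Normal.map inferInstance _ (QuotientGroup.mk'_surjective L)
    refine ih _ fun a b hab => ?_
    rw [← commutator_le_iff_le_comap_centralizer]
    refine commutator_sup_le ?_ ?_
    · refine le_trans (le_inf ?_ ?_) (hL (a + 1) b (by omega))
      · exact (commutator_mono inf_le_left le_rfl).trans
          (commutator_extendedLowerCentralSeries_le M a)
      · exact (commutator_mono inf_le_right le_rfl).trans (commutator_le_left _ _)
    · refine le_trans (le_inf ?_ ?_) (hL a (b + 1) (by omega))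
      · exact (commutator_mono inf_le_left le_rfl).trans (commutator_le_left _ _)
      · exact (commutator_mono inf_le_right le_rfl).trans
          (commutator_extendedLowerCentralSeries_le N b)

/-- Fitting's theorem: the join of two normal nilpotent subgroups is nilpotent. -/
theorem isNilpotent_sup_of_normal {M N : Subgroup G} [M.Normal] [N.Normal]
    (hM : Group.IsNilpotent M) (hN : Group.IsNilpotent N) :
    Group.IsNilpotent (M ⊔ N : Subgroup G) := by
  obtain ⟨c, hc⟩ := (isNilpotent_iff_lowerCentralSeries M).1 hM
  obtain ⟨d, hd⟩ := (isNilpotent_iff_lowerCentralSeries N).1 hN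
  refine isNilpotent_of_lowerCentralSeries_eq_bot (n := c + d)
    (le_bot_iff.1 (lowerCentralSeries_sup_le M N _ ⊥ fun a b hab => ?_))
  by_cases h : c + 1 ≤ a
  · obtain ⟨k, rfl⟩ := Nat.exists_eq_add_of_le' h
    exact inf_le_left.trans ((M.lowerCentralSeries_antitone (Nat.le_add_left c k)).trans hc.le)
  · obtain ⟨k, rfl⟩ := Nat.exists_eq_add_of_le' (show d + 1 ≤ b by omega)
    exact inf_le_right.trans ((N.lowerCentralSeries_antitone (Nat.le_add_left d k)).trans hd.le)

theorem isNilpotent_sup_of_le_normalizer {M N : Subgroup G} (hM : Group.IsNilpotent M)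
    (hN : Group.IsNilpotent N) (hMN : M ≤ normalizer N) (hNM : N ≤ normalizer M) :
    Group.IsNilpotent (M ⊔ N : Subgroup G) := by
  have : (M.subgroupOf (M ⊔ N)).Normal :=
    (normal_subgroupOf_iff_le_normalizer le_sup_left).2 (sup_le le_normalizer hNM)
  have : (N.subgroupOf (M ⊔ N)).Normal :=
    (normal_subgroupOf_iff_le_normalizer le_sup_right).2 (sup_le hMN le_normalizer)
  have h := isNilpotent_sup_of_normal
    ((Group.isNilpotent_congr (subgroupOfEquivOfLe (le_sup_left : M ≤ M ⊔ N))).2 hM)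
    ((Group.isNilpotent_congr (subgroupOfEquivOfLe (le_sup_right : N ≤ M ⊔ N))).2 hN)
  rw [← subgroupOf_sup le_sup_left le_sup_right, subgroupOf_self] at h
  exact Group.isNilpotent_top.1 h

theorem isNilpotent_conj_smul {V : Subgroup G} (hV : Group.IsNilpotent V) (g : G) :
    Group.IsNilpotent (MulAut.conj g • V : Subgroup G) :=
  (Group.isNilpotent_congr (equivSMul (MulAut.conj g) V)).1 hV

end Subgroup

namespace IsMaximalNilpotent

open Subgroup

variable {G : Type*} [Group G] {U : Subgroup G}

theorem le_of_le_normalizer (hU : IsMaximalNilpotent U) {V : Subgroup G}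
    (hV : Group.IsNilpotent V) (hUV : U ≤ normalizer V) (hVU : V ≤ normalizer U) : V ≤ U :=
  le_sup_right.trans
    (hU.2 _ le_sup_left (isNilpotent_sup_of_le_normalizer hU.1 hV hUV hVU)).ge

protected theorem conj_smul (hU : IsMaximalNilpotent U) (g : G) :
    IsMaximalNilpotent (MulAut.conj g • U) := by
  refine ⟨isNilpotent_conj_smul hU.1 g, fun V hUV hV => ?_⟩
  rw [pointwise_smul_subset_iff, ← map_inv] at hUV
  rw [hU.2 _ hUV (isNilpotent_conj_smul hV _), map_inv, smul_inv_smul]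

theorem conj_smul_le (hU : IsMaximalNilpotent U) {H : Subgroup G} (hUH : U ≤ H)
    (hHU : H ≤ normalizer U) {g : G} (hg : MulAut.conj g • H = H) : MulAut.conj g • U ≤ U := by
  refine hU.le_of_le_normalizer (isNilpotent_conj_smul hU.1 g) ?_ ?_
  · refine hUH.trans (hg.ge.trans ?_)
    exact (pointwise_smul_le_pointwise_smul_iff.2 hHU).trans (le_normalizer_map _)
  · exact ((pointwise_smul_le_pointwise_smul_iff.2 hUH).trans hg.le).trans hHU

theorem normalizer_le_normalizer (hU : IsMaximalNilpotent U) {H : Subgroup G} (hUH : U ≤ H)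
    (hHU : H ≤ normalizer U) : normalizer H ≤ normalizer (U : Set G) := by
  intro g hg
  have key : ∀ x ∈ normalizer (H : Set G), MulAut.conj x • U ≤ U := fun x hx =>
    hU.conj_smul_le hUH hHU (conjAct_pointwise_smul_eq_self hx)
  have hg' := key _ (inv_mem hg)
  rw [map_inv, ← subset_pointwise_smul_iff] at hg'
  exact conjAct_pointwise_smul_iff.1 (le_antisymm (key g hg) hg')

theorem le_normalizer_of_isNilpotent_quotient (hU : IsMaximalNilpotent U) {H K : Subgroup G}
    (hUH : U ≤ H) (hHK : H ≤ K) (hHU : H ≤ normalizer U)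
    (hQ : Group.IsNilpotent (K ⧸ (H.subgroupOf K).normalCore)) : K ≤ normalizer U := by
  set C := (H.subgroupOf K).normalCore
  set f := QuotientGroup.mk' C
  have hf : Function.Surjective f := QuotientGroup.mk'_surjective C
  set N := (normalizer (U : Set G)).subgroupOf K
  have hfN : (N.map f).comap f = N := comap_map_eq_self <| by
    rw [QuotientGroup.ker_mk']
    exact (normalCore_le _).trans (comap_mono hHU)
  have hN : normalizer (N : Set K) ≤ N := by
    intro x hx
    refine hU.normalizer_le_normalizer (H := N.map K.subtype) ?_ ?_
      (le_normalizer_map K.subtype (mem_map_of_mem _ hx))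
    · rw [subgroupOf_map_subtype]
      exact le_inf le_normalizer (hUH.trans hHK)
    · rw [subgroupOf_map_subtype]
      exact inf_le_left
  have htop : N.map f = ⊤ := by
    refine normalizerCondition_iff_only_full_group_self_normalizing.1
      Group.normalizerCondition_of_isNilpotent _ (comap_injective hf ?_)
    rw [comap_normalizer_eq_of_surjective _ hf, hfN]
    exact le_antisymm hN le_normalizer
  rw [htop, comap_top] at hfN
  exact subgroupOf_eq_top.1 hfN.symm

theorem normal_of_isKNilpotentSubnormal (hU : IsMaximalNilpotent U)
    (h : IsKNilpotentSubnormal U) : U.Normal := by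
  obtain rfl | ⟨t, c, h0, ht, hc⟩ := h
  · infer_instance
  have key : ∀ i ≤ t, U ≤ c i ∧ c i ≤ normalizer U := by
    intro i
    induction i with
    | zero => exact fun _ => ⟨h0.ge, h0.le.trans le_normalizer⟩
    | succ i ih =>
      intro hi
      obtain ⟨hUi, hiU⟩ := ih (by omega)
      obtain ⟨hlt, hstep⟩ := hc i hi
      refine ⟨hUi.trans hlt.le, ?_⟩
      obtain hn | hq := hstep
      · refine le_trans ?_ (hU.normalizer_le_normalizer hUi hiU)
        exact (normal_subgroupOf_iff_le_normalizer hlt.le).1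
          ((normal_subgroupOf_iff hlt.le).2 fun n g hn' hg => hn g hg n hn')
      · exact hU.le_normalizer_of_isNilpotent_quotient hUi hlt.le hiU hq
  exact normalizer_eq_top_iff.1 (top_le_iff.1 (ht.ge.trans (key t le_rfl).2))

theorem exists_ge [Finite G] {V : Subgroup G} (hV : Group.IsNilpotent V) :
    ∃ U, V ≤ U ∧ IsMaximalNilpotent U := by
  obtain ⟨U, hVU, hU⟩ :=
    (Set.toFinite {W : Subgroup G | Group.IsNilpotent W}).exists_le_maximal hV
  exact ⟨U, hVU, hU.prop, fun W hUW hW => hU.eq_of_le hW hUW⟩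

theorem eq_top_of_forall_eq [Finite G] (h : ∀ V : Subgroup G, IsMaximalNilpotent V → V = U) :
    U = ⊤ := by
  refine eq_top_iff.2 fun g _ => ?_
  obtain ⟨V, hgV, hV⟩ := exists_ge (@CommGroup.isNilpotent (zpowers g) IsCyclic.commGroup)
  exact h V hV ▸ hgV (mem_zpowers g)

theorem eq_of_normal (hU : IsMaximalNilpotent U) [U.Normal] {V : Subgroup G}
    (hV : IsMaximalNilpotent V) [V.Normal] : V = U :=
  hV.2 _ (hU.le_of_le_normalizer hV.1 le_normalizer_of_normal le_normalizer_of_normal) hU.1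

end IsMaximalNilpotent

theorem IsKNilpotentSubnormal.of_normal {G : Type*} [Group G] {U : Subgroup G} [U.Normal] :
    IsKNilpotentSubnormal U := by
  by_cases hU : U = ⊤
  · exact .inl hU
  refine .inr ⟨1, fun i => if i = 0 then U else ⊤, by simp, by simp, fun i hi => ?_⟩
  obtain rfl : i = 0 := by omega
  exact ⟨by simpa [lt_top_iff_ne_top] using hU,
    .inl fun g _ n hn => Subgroup.Normal.conj_mem ‹_› n hn g⟩

theorem IsMaximalNilpotent.isKNilpotentSubnormal_iff {G : Type*} [Group G] {U : Subgroup G}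
    (hU : IsMaximalNilpotent U) : IsKNilpotentSubnormal U ↔ U.Normal :=
  ⟨hU.normal_of_isKNilpotentSubnormal, fun _ => .of_normal⟩

/-- For a finite group `G`, the intersection of all maximal nilpotent subgroups `U` of `G`
that are not `K`-`𝒩`-subnormal in `G` equals the intersection of all maximal nilpotent
subgroups of `G` (an empty intersection being `G` itself, i.e. `⊤`). -/
theorem intersection_nonKNSubnormal_maximal_nilpotent
    (G : Type*) [Group G] [Finite G] :
    (⨅ U ∈ {U : Subgroup G | IsMaximalNilpotent U ∧ ¬ IsKNilpotentSubnormal U}, U) =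
      ⨅ U ∈ {U : Subgroup G | IsMaximalNilpotent U}, U := by
  refine le_antisymm (le_iInf₂ fun U hU => ?_) (biInf_mono fun _ h => h.1)
  set D := ⨅ U ∈ {U : Subgroup G | IsMaximalNilpotent U ∧ ¬ IsKNilpotentSubnormal U}, U with hD
  by_cases hUs : IsKNilpotentSubnormal U
  swap
  · exact iInf₂_le U ⟨hU, hUs⟩
  have hUn : U.Normal := hU.isKNilpotentSubnormal_iff.1 hUs
  by_cases hne : ∃ V : Subgroup G, IsMaximalNilpotent V ∧ ¬ IsKNilpotentSubnormal V
  · obtain ⟨V, hV⟩ := hne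
    have hDV : D ≤ V := iInf₂_le V hV
    have hDnil : Group.IsNilpotent D := by
      have := hV.1.1
      exact (Group.isNilpotent_congr (Subgroup.subgroupOfEquivOfLe hDV)).1 inferInstance
    have hDn : D.Normal := by
      refine ⟨fun n hn g => ?_⟩
      simp only [hD, Subgroup.mem_iInf] at hn ⊢
      rintro W ⟨hW, hWs⟩
      have hW' := hW.conj_smul g⁻¹
      have hmem := hn (MulAut.conj g⁻¹ • W) ⟨hW', fun hs => hWs ?_⟩
      · rw [map_inv, Subgroup.mem_inv_pointwise_smul_iff] at hmem
        exact hmem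
      · have hWn := hW'.isKNilpotentSubnormal_iff.1 hs
        have hconj := Subgroup.Normal.conj_smul_eq_self g (MulAut.conj g⁻¹ • W)
        rw [map_inv, smul_inv_smul, ← map_inv] at hconj
        exact hconj ▸ hs
    exact hU.le_of_le_normalizer hDnil Subgroup.le_normalizer_of_normal
      Subgroup.le_normalizer_of_normal
  · push Not at hne
    refine le_top.trans (IsMaximalNilpotent.eq_top_of_forall_eq fun V hV => ?_).ge
    have := hV.isKNilpotentSubnormal_iff.1 (hne V hV)
    exact IsMaximalNilpotent.eq_of_normal hU hV
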